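/- Let X be a finite index set with weights p_x ≥ 0 summing to 1, and for each x ∈ X let P_x and Q_x be probability distributions on a finite index set S_x (nonnegative entries summing to 1). Form the combined distributions on the disjoint union ⊔_x S_x by assigning probabilities p_x·P_x(s) and p_x·Q_x(s) to the element s of the copy S_x. Then the DLITE of the combined distributions equals the weighted sum of sub-system DLITEs: DL(combined P, combined Q) = ∑_{x∈X} p_x · DL(P_x, Q_x). -/

import Mathlib

open Real Finset

/-- lit(p,q) = |p(1 - log p) - q(1 - log q)|, natural log, with 0*log 0 = 0
(automatic since Real.log 0 = 0). -/
noncomputable def lit (p q : ℝ) : ℝ :=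
  |p * (1 - Real.log p) - q * (1 - Real.log q)|

/-- δh(p,q) = |p²(1 - 2 log p) - q²(1 - 2 log q)| / (2(p+q)), with δh(0,0) = 0
(automatic since division by zero is 0 in Lean). -/
noncomputable def deltaH (p q : ℝ) : ℝ :=
  |p ^ 2 * (1 - 2 * Real.log p) - q ^ 2 * (1 - 2 * Real.log q)| / (2 * (p + q))

/-- dl(p,q) = lit(p,q) - δh(p,q). -/
noncomputable def dl (p q : ℝ) : ℝ := lit p q - deltaH p q

/-- DLITE of two distributions on a finite index set: DL(P,Q) = ∑ i, dl(P i, Q i). -/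
noncomputable def DL {ι : Type*} [Fintype ι] (P Q : ι → ℝ) : ℝ :=
  ∑ i, dl (P i) (Q i)

/-- `IsProbDist P` : nonnegative real entries summing to 1. -/
def IsProbDist {ι : Type*} [Fintype ι] (P : ι → ℝ) : Prop :=
  (∀ i, 0 ≤ P i) ∧ ∑ i, P i = 1

lemma mul_one_sub_log_mono {p q : ℝ} (hq : 0 ≤ q) (hqp : q ≤ p) (hp : p ≤ 1) :
    q * (1 - Real.log q) ≤ p * (1 - Real.log p) := by
  have hlp : Real.log p ≤ 0 := Real.log_nonpos (hq.trans hqp) hp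
  rcases hq.eq_or_lt with rfl | hq0
  · rw [zero_mul]
    exact mul_nonneg hqp (by linarith)
  · have hp0 : 0 < p := hq0.trans_le hqp
    have hlog : Real.log p - Real.log q ≤ p / q - 1 := by
      rw [← Real.log_div hp0.ne' hq0.ne']
      exact Real.log_le_sub_one_of_pos (div_pos hp0 hq0)
    have hmul : q * (Real.log p - Real.log q) ≤ p - q := by
      calc q * (Real.log p - Real.log q) ≤ q * (p / q - 1) :=
            mul_le_mul_of_nonneg_left hlog hq
        _ = p - q := by field_simp
    have hdiff : 0 ≤ (p - q) * (-Real.log p) :=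
      mul_nonneg (sub_nonneg.2 hqp) (neg_nonneg.2 hlp)
    linarith

lemma sq_mul_one_sub_two_log_mono {p q : ℝ} (hq : 0 ≤ q) (hqp : q ≤ p) (hp : p ≤ 1) :
    q ^ 2 * (1 - 2 * Real.log q) ≤ p ^ 2 * (1 - 2 * Real.log p) := by
  have h := mul_one_sub_log_mono (sq_nonneg q) (pow_le_pow_left₀ hq hqp 2)
    (pow_le_one₀ (hq.trans hqp) hp)
  simpa only [Real.log_pow, Nat.cast_ofNat] using h

lemma dl_comm (p q : ℝ) : dl p q = dl q p := by
  unfold dl lit deltaH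
  rw [abs_sub_comm, abs_sub_comm (p ^ 2 * _), add_comm p q]

/-- On `[0, 1]` the absolute values in `dl` can be removed. -/
lemma dl_of_le {p q : ℝ} (hq : 0 ≤ q) (hqp : q ≤ p) (hp : p ≤ 1) :
    dl p q = p * (1 - Real.log p) - q * (1 - Real.log q) -
      (p ^ 2 * (1 - 2 * Real.log p) - q ^ 2 * (1 - 2 * Real.log q)) / (2 * (p + q)) := by
  unfold dl lit deltaH
  rw [abs_of_nonneg (sub_nonneg.2 (mul_one_sub_log_mono hq hqp hp)),
    abs_of_nonneg (sub_nonneg.2 (sq_mul_one_sub_two_log_mono hq hqp hp))]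

lemma dl_zero_zero : dl 0 0 = 0 := by simp [dl, lit, deltaH]

lemma mul_log_mul {c : ℝ} (hc : c ≠ 0) (p : ℝ) :
    p * Real.log (c * p) = p * Real.log c + p * Real.log p := by
  rcases eq_or_ne p 0 with rfl | hp
  · simp
  · rw [Real.log_mul hc hp, mul_add]

lemma dl_mul_of_le {c p q : ℝ} (hc0 : 0 ≤ c) (hc1 : c ≤ 1) (hq : 0 ≤ q) (hqp : q ≤ p)
    (hp : p ≤ 1) : dl (c * p) (c * q) = c * dl p q := by
  rcases hc0.eq_or_lt with rfl | hc
  · simp [dl_zero_zero]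
  have hp0 : 0 ≤ p := hq.trans hqp
  rcases hp0.eq_or_lt with rfl | hp0
  · obtain rfl : q = 0 := le_antisymm hqp hq
    simp [dl_zero_zero]
  have hpq : 0 < p + q := by linarith
  rw [dl_of_le hq hqp hp, dl_of_le (mul_nonneg hc0 hq) (mul_le_mul_of_nonneg_left hqp hc0)
    (mul_le_one₀ hc1 hp0.le hp)]
  have h₁ := mul_log_mul hc.ne' p
  have h₂ := mul_log_mul hc.ne' q
  have hnum : (c * p) ^ 2 * (1 - 2 * Real.log (c * p)) - (c * q) ^ 2 * (1 - 2 * Real.log (c * q))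
      = c ^ 2 * (p ^ 2 * (1 - 2 * Real.log p) - q ^ 2 * (1 - 2 * Real.log q)
        - 2 * (p ^ 2 - q ^ 2) * Real.log c) := by
    linear_combination (-2 * c ^ 2 * p) * h₁ + (2 * c ^ 2 * q) * h₂
  have hlit : c * p * (1 - Real.log (c * p)) - c * q * (1 - Real.log (c * q))
      = c * (p * (1 - Real.log p) - q * (1 - Real.log q) - (p - q) * Real.log c) := by
    linear_combination (-c) * h₁ + c * h₂
  rw [hnum, hlit]
  field_simp
  ring

/-- `dl` is homogeneous of degree one on `[0, 1]`. -/
lemma dl_mul {c p q : ℝ} (hc0 : 0 ≤ c) (hc1 : c ≤ 1) (hp0 : 0 ≤ p) (hp1 : p ≤ 1)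
    (hq0 : 0 ≤ q) (hq1 : q ≤ 1) : dl (c * p) (c * q) = c * dl p q := by
  rcases le_total q p with h | h
  · exact dl_mul_of_le hc0 hc1 hq0 h hp1
  · rw [dl_comm, dl_comm p q]
    exact dl_mul_of_le hc0 hc1 hp0 h hq1

lemma IsProbDist.le_one {ι : Type*} [Fintype ι] {P : ι → ℝ} (h : IsProbDist P) (i : ι) :
    P i ≤ 1 :=
  h.2 ▸ Finset.single_le_sum (fun j _ => h.1 j) (Finset.mem_univ i)

theorem DL_subsystem_weighted_sum {X : Type*} [Fintype X] {S : X → Type*} [∀ x, Fintype (S x)]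
    (p : X → ℝ) (hp : IsProbDist p)
    (P Q : ∀ x, S x → ℝ)
    (hP : ∀ x, IsProbDist (P x)) (hQ : ∀ x, IsProbDist (Q x)) :
    DL (fun i : Σ x, S x => p i.1 * P i.1 i.2) (fun i : Σ x, S x => p i.1 * Q i.1 i.2) =
      ∑ x, p x * DL (P x) (Q x) := by
  unfold DL
  rw [Fintype.sum_sigma]
  refine Finset.sum_congr rfl fun x _ => ?_
  rw [Finset.mul_sum]
  exact Finset.sum_congr rfl fun s _ => dl_mul (hp.1 x) (hp.le_one x) ((hP x).1 s)
    ((hP x).le_one s) ((hQ x).1 s) ((hQ x).le_one s)
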